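/- Let 0 < ε < 1/2 and let h̄, ḡ : [0,1] → ℂ be smooth maps such that (h̄,ḡ) satisfies the stabilization conditions on [0,1] and the slope h̄'/|h̄'| is not constant on [ε,1−ε]. Set P := [0,ε] ∪ [1−ε,1]. Then for every η > 0 there exists δ > 0 with the following property: for every smooth map h : [0,1] → ℂ with ‖h − h̄‖_{C¹} < δ and every smooth map g₀ : P → ℂ with sup_{r∈P}(|g₀(r)−ḡ(r)| + |g₀'(r)−ḡ'(r)|) < δ such that (h,g₀) satisfies the stabilization conditions on P, there exists a smooth map g : [0,1] → ℂ with ‖g − ḡ‖_{C¹} < η, g = g₀ on P, and (h,g) satisfying the stabilization conditions on [0,1]. -/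

import Mathlib

/-- The real inner product `⟨z,w⟩ = Re (z · conj w)` on `ℂ ≅ ℝ²`. -/
noncomputable def rinner (z w : ℂ) : ℝ := (z * (starRingEnd ℂ) w).re

/-- The pair `(h,g)` satisfies the stabilization conditions on `S`:
`⟨g'(r), i·h'(r)⟩ = 0` and `⟨g(r), i·h'(r)⟩ > 0` for all `r ∈ S`. -/
def StabOn (h g : ℝ → ℂ) (S : Set ℝ) : Prop :=
  ∀ r ∈ S, rinner (deriv g r) (Complex.I * deriv h r) = 0 ∧
    0 < rinner (g r) (Complex.I * deriv h r)

/-- The `C¹`-norm of a map on `[0,1]`: `sup |f| + sup |f'|`. -/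
noncomputable def C1Norm (f : ℝ → ℂ) : ℝ :=
  (⨆ r : Set.Icc (0:ℝ) 1, ‖f r.1‖) + (⨆ r : Set.Icc (0:ℝ) 1, ‖deriv f r.1‖)

open Set MeasureTheory
open scoped ContDiff Manifold

lemma rinner_eq (z w : ℂ) : rinner z w = z.re * w.re + z.im * w.im := by
  simp [rinner]

lemma abs_rinner_le (z w : ℂ) : |rinner z w| ≤ ‖z‖ * ‖w‖ := by
  simpa [rinner] using Complex.abs_re_le_norm (z * (starRingEnd ℂ) w)

lemma rinner_sub_left (z z' w : ℂ) : rinner (z - z') w = rinner z w - rinner z' w := by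
  simp [rinner_eq]; ring

lemma rinner_I_mul_sub (z w w' : ℂ) :
    rinner z (Complex.I * (w - w')) = rinner z (Complex.I * w) - rinner z (Complex.I * w') := by
  simp [rinner_eq]; ring

lemma ContDiff.rinner {f g : ℝ → ℂ} {n : ℕ∞ω} (hf : ContDiff ℝ n f) (hg : ContDiff ℝ n g) :
    ContDiff ℝ n fun r => rinner (f r) (g r) := by
  simp only [rinner_eq]
  exact ((Complex.reCLM.contDiff.comp hf).mul (Complex.reCLM.contDiff.comp hg)).add
    ((Complex.imCLM.contDiff.comp hf).mul (Complex.imCLM.contDiff.comp hg))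

/-- The orthogonal projection onto the real line spanned by `p` is norm nonincreasing. -/
lemma norm_rinner_div_smul_le (w p : ℂ) : ‖(rinner w p / ‖p‖ ^ 2) • p‖ ≤ ‖w‖ := by
  rcases eq_or_ne p 0 with rfl | hp
  · simp
  have hp' : 0 < ‖p‖ := norm_pos_iff.2 hp
  rw [norm_smul, Real.norm_eq_abs, abs_div, abs_of_pos (pow_pos hp' 2), div_mul_eq_mul_div,
    div_le_iff₀ (pow_pos hp' 2)]
  nlinarith [abs_rinner_le w p]

lemma rinner_div_smul_eq {w p : ℂ} (hp : p ≠ 0) (h : rinner w (Complex.I * p) = 0) :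
    (rinner w p / ‖p‖ ^ 2) • p = w := by
  have hp' : ‖p‖ ^ 2 ≠ 0 := pow_ne_zero 2 (norm_ne_zero_iff.2 hp)
  have hn : ‖p‖ ^ 2 = p.re * p.re + p.im * p.im := by
    rw [← Complex.normSq_eq_norm_sq, Complex.normSq_apply]
  simp only [rinner_eq, Complex.I_mul_re, Complex.I_mul_im] at h
  apply Complex.ext
  · rw [Complex.smul_re, smul_eq_mul, div_mul_eq_mul_div, div_eq_iff hp', hn, rinner_eq]
    linear_combination p.im * h
  · rw [Complex.smul_im, smul_eq_mul, div_mul_eq_mul_div, div_eq_iff hp', hn, rinner_eq]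
    linear_combination -p.re * h

lemma bddAbove_range_norm_Icc {f : ℝ → ℂ} (hf : Continuous f) :
    BddAbove (range fun r : Icc (0 : ℝ) 1 => ‖f r.1‖) :=
  (isCompact_range (hf.comp continuous_subtype_val).norm).bddAbove

lemma norm_deriv_le_C1Norm {f : ℝ → ℂ} (hf : ContDiff ℝ ∞ f) {r : ℝ} (hr : r ∈ Icc (0 : ℝ) 1) :
    ‖deriv f r‖ ≤ C1Norm f :=
  (le_ciSup (bddAbove_range_norm_Icc (contDiff_infty_iff_deriv.1 hf).2.continuous) ⟨r, hr⟩).trans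
    (le_add_of_nonneg_left (Real.iSup_nonneg fun _ => norm_nonneg _))

lemma C1Norm_le {f : ℝ → ℂ} {a b : ℝ} (ha : ∀ r ∈ Icc (0 : ℝ) 1, ‖f r‖ ≤ a)
    (hb : ∀ r ∈ Icc (0 : ℝ) 1, ‖deriv f r‖ ≤ b) : C1Norm f ≤ a + b := by
  have : Nonempty (Icc (0 : ℝ) 1) := ⟨⟨0, by simp⟩⟩
  exact add_le_add (ciSup_le fun r => ha r r.2) (ciSup_le fun r => hb r r.2)

lemma exists_linear_comb_eq {A B : ℂ} (hA : ‖A - 1‖ ≤ 1 / 4) (hB : ‖B - Complex.I‖ ≤ 1 / 4)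
    (c : ℂ) : ∃ a b : ℝ, a • A + b • B = c ∧ |a| ≤ 2 * ‖c‖ ∧ |b| ≤ 2 * ‖c‖ := by
  let T : ℂ →ₗ[ℝ] ℂ :=
    Complex.reLm.smulRight A + Complex.imLm.smulRight B
  have hT : ∀ z, T z = z.re • A + z.im • B := fun z => rfl
  have key : ∀ z, ‖z‖ ≤ 2 * ‖T z‖ := fun z => by
    have h1 : z = T z - (z.re • (A - 1) + z.im • (B - Complex.I)) := by
      rw [hT]
      conv_lhs => rw [← Complex.re_add_im z]
      simp only [Complex.real_smul]
      ring
    have h2 : ‖z.re • (A - 1)‖ ≤ ‖z‖ * (1 / 4) := by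
      rw [norm_smul]
      exact mul_le_mul (Complex.abs_re_le_norm z) hA (norm_nonneg _) (norm_nonneg _)
    have h3 : ‖z.im • (B - Complex.I)‖ ≤ ‖z‖ * (1 / 4) := by
      rw [norm_smul]
      exact mul_le_mul (Complex.abs_im_le_norm z) hB (norm_nonneg _) (norm_nonneg _)
    have h4 := norm_sub_le (T z) (z.re • (A - 1) + z.im • (B - Complex.I))
    rw [← h1] at h4
    linarith [norm_add_le (z.re • (A - 1)) (z.im • (B - Complex.I))]
  have hinj : Function.Injective T := by
    rw [injective_iff_map_eq_zero]
    intro z hz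
    have := key z
    rw [hz, norm_zero, mul_zero] at this
    exact norm_le_zero_iff.1 this
  obtain ⟨z, rfl⟩ := LinearMap.injective_iff_surjective.1 hinj c
  exact ⟨z.re, z.im, rfl, (Complex.abs_re_le_norm z).trans (key z),
    (Complex.abs_im_le_norm z).trans (key z)⟩

/-- If a continuous nowhere vanishing curve lies in the kernel of a nonzero functional, its
direction is constant. -/
lemma div_norm_eq_of_mem_ker {a b : ℝ} {f : ℝ → ℂ} (hf : ContinuousOn f (Icc a b))
    (hf0 : ∀ r ∈ Icc a b, f r ≠ 0) {L : ℂ →ₗ[ℝ] ℝ} (hL : L ≠ 0)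
    (hLf : ∀ r ∈ Icc a b, L (f r) = 0) {r₁ r₂ : ℝ} (h₁ : r₁ ∈ Icc a b) (h₂ : r₂ ∈ Icc a b) :
    f r₁ / (‖f r₁‖ : ℂ) = f r₂ / (‖f r₂‖ : ℂ) := by
  have hLz : ∀ z : ℂ, L z = z.re * L 1 + z.im * L Complex.I := fun z => by
    conv_lhs => rw [← Complex.re_add_im z, ← mul_one (z.re : ℂ)]
    rw [map_add, ← Complex.real_smul, ← Complex.real_smul, map_smul, map_smul, smul_eq_mul,
      smul_eq_mul]
  have hcol : ∀ z w : ℂ, L z = 0 → L w = 0 → rinner z (Complex.I * w) = 0 := by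
    intro z w hz hw
    simp only [rinner_eq, Complex.I_mul_re, Complex.I_mul_im]
    rw [hLz] at hz hw
    by_contra hne
    refine hL (LinearMap.ext fun x => ?_)
    have e1 : L 1 = 0 := by
      refine (mul_eq_zero.1 ?_).resolve_left hne
      linear_combination w.im * (-hz) + z.im * hw
    have e2 : L Complex.I = 0 := by
      refine (mul_eq_zero.1 ?_).resolve_left hne
      linear_combination w.re * hz - z.re * hw
    rw [hLz, e1, e2]
    simp
  have hsm : ∀ r ∈ Icc a b, (rinner (f r) (f r₁) / ‖f r₁‖ ^ 2) • f r₁ = f r := fun r hr =>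
    rinner_div_smul_eq (hf0 r₁ h₁) (hcol _ _ (hLf r hr) (hLf r₁ h₁))
  have hcont : ContinuousOn (fun r => rinner (f r) (f r₁)) (Icc a b) := by
    simp only [rinner_eq]
    exact ((Complex.continuous_re.comp_continuousOn hf).mul continuousOn_const).add
      ((Complex.continuous_im.comp_continuousOn hf).mul continuousOn_const)
  have hne : ∀ r ∈ Icc a b, rinner (f r) (f r₁) ≠ 0 := fun r hr h0 => hf0 r hr <| by
    rw [← hsm r hr, h0]
    simp
  have hpos₁ : 0 < rinner (f r₁) (f r₁) := by
    refine lt_of_le_of_ne ?_ (hne r₁ h₁).symm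
    rw [rinner_eq]
    exact add_nonneg (mul_self_nonneg _) (mul_self_nonneg _)
  have hpos₂ : 0 < rinner (f r₂) (f r₁) := by
    by_contra hneg
    obtain ⟨r, hr, hr0⟩ := isPreconnected_Icc.intermediate_value h₂ h₁ hcont
      (mem_Icc.2 ⟨not_lt.1 hneg, hpos₁.le⟩)
    exact hne r hr hr0
  have hray : SameRay ℝ (f r₁) (f r₂) := by
    rw [← hsm r₂ h₂]
    exact SameRay.sameRay_nonneg_smul_right _ (by positivity)
  have := hray.inv_norm_smul_eq (hf0 r₁ h₁) (hf0 r₂ h₂)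
  simpa [div_eq_inv_mul] using this

/-- Integrating a curve of nonconstant direction against smooth weights supported in the
interior reaches every vector. -/
lemma exists_weight_integral_eq {a b : ℝ} (ha : 0 ≤ a) (hab : a < b) (hb : b ≤ 1) {f : ℝ → ℂ}
    (hf : Continuous f) (hf0 : ∀ r ∈ Icc a b, f r ≠ 0)
    (hnc : ∃ r₁ ∈ Icc a b, ∃ r₂ ∈ Icc a b, f r₁ / (‖f r₁‖ : ℂ) ≠ f r₂ / (‖f r₂‖ : ℂ)) (z : ℂ) :
    ∃ φ : ℝ → ℝ, ContDiff ℝ ∞ φ ∧ (∀ r ∉ Ioo a b, φ r = 0) ∧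
      ∫ r in (0 : ℝ)..1, φ r • f r = z := by
  have hint : ∀ φ : ℝ → ℝ, ContDiff ℝ ∞ φ →
      IntervalIntegrable (fun r => φ r • f r) volume 0 1 := fun φ hφ =>
    (hφ.continuous.smul hf).intervalIntegrable _ _
  let V : Submodule ℝ ℂ :=
    { carrier := {z | ∃ φ : ℝ → ℝ, ContDiff ℝ ∞ φ ∧ (∀ r ∉ Ioo a b, φ r = 0) ∧
        ∫ r in (0 : ℝ)..1, φ r • f r = z}
      zero_mem' := ⟨0, contDiff_const, fun _ _ => rfl, by simp⟩
      add_mem' := by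
        rintro _ _ ⟨φ, hφ, hφ0, rfl⟩ ⟨ψ, hψ, hψ0, rfl⟩
        refine ⟨fun r => φ r + ψ r, hφ.add hψ, fun r hr => by simp [hφ0 r hr, hψ0 r hr], ?_⟩
        simp only [add_smul]
        exact intervalIntegral.integral_add (hint φ hφ) (hint ψ hψ)
      smul_mem' := by
        rintro c _ ⟨φ, hφ, hφ0, rfl⟩
        refine ⟨fun r => c * φ r, contDiff_const.mul hφ, fun r hr => by simp [hφ0 r hr], ?_⟩
        simp only [mul_smul]
        exact intervalIntegral.integral_smul c _ }
  suffices hV : V = ⊤ from (hV ▸ Submodule.mem_top : z ∈ V)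
  by_contra hV
  obtain ⟨L, hL0, hVL⟩ := Submodule.exists_le_ker_of_lt_top V (lt_top_iff_ne_top.2 hV)
  let L' : ℂ →L[ℝ] ℝ := LinearMap.toContinuousLinearMap L
  have hLf : Continuous fun r => L' (f r) := L'.continuous.comp hf
  have hae := isOpen_Ioo.ae_eq_zero_of_integral_contDiff_smul_eq_zero (μ := volume)
    (U := Ioo a b) (hLf.locallyIntegrable.locallyIntegrableOn _) (by
      intro φ hφ _ hsupp
      have hφ0 : ∀ r ∉ Ioo a b, φ r = 0 := fun r hr =>
        image_eq_zero_of_notMem_tsupport fun h => hr (hsupp h)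
      rw [← intervalIntegral.integral_eq_integral_of_support_subset (a := 0) (b := 1)]
      · have : L' (∫ r in (0 : ℝ)..1, φ r • f r) = 0 := hVL ⟨φ, hφ, hφ0, rfl⟩
        rw [← L'.intervalIntegral_comp_comm (hint φ hφ)] at this
        simpa only [map_smul] using this
      · intro r hr
        have hr' : r ∈ Ioo a b := by
          by_contra hr'
          exact hr (by simp [hφ0 r hr'])
        exact ⟨ha.trans_lt hr'.1, (hr'.2.trans_le hb).le⟩)
  have hzero : EqOn (fun r => L' (f r)) 0 (Icc a b) := by
    refine Measure.eqOn_Icc_of_ae_eq volume hab.ne ?_ hLf.continuousOn continuousOn_const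
    rw [← restrict_Ioo_eq_restrict_Icc]
    exact (ae_restrict_iff' measurableSet_Ioo).2 hae
  obtain ⟨r₁, h₁, r₂, h₂, hne⟩ := hnc
  exact hne (div_norm_eq_of_mem_ker hf.continuousOn hf0 hL0 hzero h₁ h₂)

lemma contDiff_const_add_integral {v : ℝ → ℂ} (hv : ContDiff ℝ ∞ v) (c : ℂ) :
    ContDiff ℝ ∞ (fun r => c + ∫ s in (0 : ℝ)..r, v s) ∧
      ∀ r, deriv (fun r => c + ∫ s in (0 : ℝ)..r, v s) r = v r := by
  have hd : ∀ r, HasDerivAt (fun r => c + ∫ s in (0 : ℝ)..r, v s) (v r) r := fun r =>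
    ((hv.continuous.integral_hasStrictDerivAt 0 r).hasDerivAt).const_add c
  have hd' : deriv (fun r => c + ∫ s in (0 : ℝ)..r, v s) = v := funext fun r => (hd r).deriv
  exact ⟨contDiff_infty_iff_deriv.2 ⟨fun r => (hd r).differentiableAt, hd'.symm ▸ hv⟩,
    fun r => (hd r).deriv⟩

/-- A smooth velocity tangent to `h`, extending that of `g₀` and close to that of `g`. -/
lemma exists_tangential_extension {h g g₀ : ℝ → ℂ} (hh : ContDiff ℝ ∞ h) (hg : ContDiff ℝ ∞ g)
    (hg₀ : ContDiff ℝ ∞ g₀) (hh0 : ∀ r ∈ Icc (0 : ℝ) 1, deriv h r ≠ 0) {P : Set ℝ}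
    (hP : IsClosed P) (hP1 : P ⊆ Icc 0 1) {δ : ℝ} (hδ : 0 < δ)
    (hclose : ∀ r ∈ P, ‖deriv g₀ r - deriv g r‖ < δ)
    (htan : ∀ r ∈ P, rinner (deriv g₀ r) (Complex.I * deriv h r) = 0) :
    ∃ l : ℝ → ℝ, ContDiff ℝ ∞ l ∧ (∀ r ∈ P, l r • deriv h r = deriv g₀ r) ∧
      ∀ r ∈ Icc (0 : ℝ) 1, ∀ μ : ℝ,
        ‖l r • deriv h r - deriv g r‖ ≤ δ + 2 * ‖deriv g r - μ • deriv h r‖ := by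
  have hh' := (contDiff_infty_iff_deriv.1 hh).2
  have hg' := (contDiff_infty_iff_deriv.1 hg).2
  have hg₀' := (contDiff_infty_iff_deriv.1 hg₀).2
  have hU : IsClosed {r | δ ≤ ‖deriv g₀ r - deriv g r‖} :=
    isClosed_le continuous_const (hg₀'.continuous.sub hg'.continuous).norm
  obtain ⟨χ, hχ0, hχ1, hχ⟩ := exists_contMDiffMap_zero_one_of_isClosed (n := (⊤ : ℕ∞)) 𝓘(ℝ, ℝ) hU hP
    (disjoint_left.2 fun r hr hrP => (hclose r hrP).not_ge hr)
  have hχs : ContDiff ℝ ∞ χ := χ.contMDiff.contDiff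
  let w : ℝ → ℂ := fun r => deriv g r + χ r • (deriv g₀ r - deriv g r)
  have hw : ContDiff ℝ ∞ w := hg'.add (hχs.smul (hg₀'.sub hg'))
  let D : ℝ → ℝ := fun r => ‖deriv h r‖ ^ 2 + (expNegInvGlue (-r) + expNegInvGlue (r - 1))
  have hD : ContDiff ℝ ∞ D := (hh'.norm_sq ℝ).add
    ((expNegInvGlue.contDiff.comp contDiff_neg).add
      (expNegInvGlue.contDiff.comp (contDiff_id.sub contDiff_const)))
  have hDI : ∀ r ∈ Icc (0 : ℝ) 1, D r = ‖deriv h r‖ ^ 2 := fun r hr => by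
    simp only [D]
    rw [expNegInvGlue.zero_of_nonpos (neg_nonpos.2 hr.1),
      expNegInvGlue.zero_of_nonpos (sub_nonpos.2 hr.2), add_zero, add_zero]
  have hD0 : ∀ r, D r ≠ 0 := fun r => by
    by_cases hr : r ∈ Icc (0 : ℝ) 1
    · rw [hDI r hr]
      exact pow_ne_zero 2 (norm_ne_zero_iff.2 (hh0 r hr))
    · have h1 := expNegInvGlue.nonneg (-r)
      have h2 := expNegInvGlue.nonneg (r - 1)
      refine (add_pos_of_nonneg_of_pos (sq_nonneg _) ?_).ne'
      rcases lt_or_ge r 0 with hr0 | hr0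
      · linarith [expNegInvGlue.pos_of_pos (neg_pos.2 hr0)]
      · have : 0 < r - 1 := by
          by_contra hr1
          exact hr ⟨hr0, by linarith⟩
        linarith [expNegInvGlue.pos_of_pos this]
  refine ⟨fun r => rinner (w r) (deriv h r) / D r, (hw.rinner hh').div hD hD0, ?_, ?_⟩
  · intro r hr
    have hwr : w r = deriv g₀ r := by
      simp [w, show χ r = 1 from hχ1 hr]
    simp only [hDI r (hP1 hr), hwr]
    exact rinner_div_smul_eq (hh0 r (hP1 hr)) (htan r hr)
  · intro r hr μ
    simp only [hDI r hr]
    set p := deriv h r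
    have hp0 : p ≠ 0 := hh0 r hr
    have hwg : ‖w r - deriv g r‖ ≤ δ := by
      simp only [w, add_sub_cancel_left]
      rw [norm_smul, Real.norm_eq_abs, abs_of_nonneg (hχ r).1]
      by_cases hrU : δ ≤ ‖deriv g₀ r - deriv g r‖
      · rw [show χ r = 0 from hχ0 hrU, zero_mul]
        exact hδ.le
      · exact (mul_le_of_le_one_left (norm_nonneg _) (hχ r).2).trans (not_le.1 hrU).le
    have hμ : (rinner (μ • p) p / ‖p‖ ^ 2) • p = μ • p := by
      apply rinner_div_smul_eq hp0
      simp [rinner_eq]; ring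
    have hdecomp : (rinner (w r) p / ‖p‖ ^ 2) • p - deriv g r =
        (rinner (w r - deriv g r) p / ‖p‖ ^ 2) • p +
          ((rinner (deriv g r - μ • p) p / ‖p‖ ^ 2) • p - (deriv g r - μ • p)) := by
      rw [rinner_sub_left, rinner_sub_left (deriv g r) (μ • p), sub_div, sub_div, sub_smul,
        sub_smul, hμ]
      abel
    rw [hdecomp]
    have h1 := norm_rinner_div_smul_le (w r - deriv g r) p
    have h2 := norm_rinner_div_smul_le (deriv g r - μ • p) p
    have h3 := norm_sub_le ((rinner (deriv g r - μ • p) p / ‖p‖ ^ 2) • p) (deriv g r - μ • p)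
    exact (norm_add_le _ _).trans (by linarith)

lemma exists_bound_Icc {E : Type*} [NormedAddCommGroup E] {f : ℝ → E}
    (hf : ContinuousOn f (Icc (0 : ℝ) 1)) : ∃ K, 0 ≤ K ∧ ∀ r ∈ Icc (0 : ℝ) 1, ‖f r‖ ≤ K := by
  obtain ⟨K, hK⟩ := isCompact_Icc.exists_bound_of_continuousOn hf
  exact ⟨K, (norm_nonneg _).trans (hK 0 (by simp)), hK⟩

lemma norm_integral_le_of_le_Icc {f : ℝ → ℂ} {C : ℝ} (h : ∀ r ∈ Icc (0 : ℝ) 1, ‖f r‖ ≤ C) {r : ℝ}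
    (hr : r ∈ Icc (0 : ℝ) 1) : ‖∫ s in (0 : ℝ)..r, f s‖ ≤ C := by
  have hC : 0 ≤ C := (norm_nonneg _).trans (h r hr)
  refine (intervalIntegral.norm_integral_le_of_norm_le_const (C := C) fun s hs => ?_).trans ?_
  · rw [uIoc_of_le hr.1] at hs
    exact h s ⟨hs.1.le, hs.2.trans hr.2⟩
  · rw [sub_zero, abs_of_nonneg hr.1]
    exact mul_le_of_le_one_right hC hr.2

lemma norm_integral_smul_sub_le {φ : ℝ → ℝ} {u v : ℝ → ℂ} {K δ : ℝ} (hφ : Continuous φ)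
    (hu : Continuous u) (hv : Continuous v) (hK0 : 0 ≤ K) (hK : ∀ r ∈ Icc (0 : ℝ) 1, ‖φ r‖ ≤ K)
    (huv : ∀ r ∈ Icc (0 : ℝ) 1, ‖u r - v r‖ ≤ δ) :
    ‖(∫ r in (0 : ℝ)..1, φ r • u r) - ∫ r in (0 : ℝ)..1, φ r • v r‖ ≤ K * δ := by
  have hφu : Continuous fun r => φ r • u r := hφ.smul hu
  have hφv : Continuous fun r => φ r • v r := hφ.smul hv
  rw [← intervalIntegral.integral_sub (hφu.intervalIntegrable _ _) (hφv.intervalIntegrable _ _)]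
  refine norm_integral_le_of_le_Icc (fun r hr => ?_) (right_mem_Icc.2 zero_le_one)
  rw [← smul_sub, norm_smul]
  exact mul_le_mul (hK r hr) (huv r hr) (norm_nonneg _) hK0

/-- stability of the stabilization problem under `C¹`-small
perturbations, when the slope of `h̄` is nonconstant on `[ε,1−ε]`. -/
theorem stmt6 (ε : ℝ) (hε0 : 0 < ε) (hε : ε < 1/2)
    (hbar gbar : ℝ → ℂ)
    (hbar_sm : ContDiff ℝ (⊤ : ℕ∞) hbar) (gbar_sm : ContDiff ℝ (⊤ : ℕ∞) gbar)
    (hstab : StabOn hbar gbar (Set.Icc 0 1))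
    (hnc : ∃ r₁ ∈ Set.Icc ε (1 - ε), ∃ r₂ ∈ Set.Icc ε (1 - ε),
      deriv hbar r₁ / (‖deriv hbar r₁‖ : ℂ) ≠ deriv hbar r₂ / (‖deriv hbar r₂‖ : ℂ)) :
    ∀ η : ℝ, 0 < η → ∃ δ : ℝ, 0 < δ ∧
      ∀ h : ℝ → ℂ, ContDiff ℝ (⊤ : ℕ∞) h →
        C1Norm (fun r => h r - hbar r) < δ →
        ∀ g₀ : ℝ → ℂ, ContDiff ℝ (⊤ : ℕ∞) g₀ →
          (∀ r ∈ Set.Icc (0:ℝ) ε ∪ Set.Icc (1 - ε) 1,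
            ‖g₀ r - gbar r‖ + ‖deriv g₀ r - deriv gbar r‖ < δ) →
          StabOn h g₀ (Set.Icc 0 ε ∪ Set.Icc (1 - ε) 1) →
          ∃ g : ℝ → ℂ, ContDiff ℝ (⊤ : ℕ∞) g ∧
            C1Norm (fun r => g r - gbar r) < η ∧
            Set.EqOn g g₀ (Set.Icc 0 ε ∪ Set.Icc (1 - ε) 1) ∧
            StabOn h g (Set.Icc 0 1) := by
  intro η hη
  have hI1 : (1 : ℝ) ∈ Icc (0 : ℝ) 1 := by simp
  have hh' := (contDiff_infty_iff_deriv.1 hbar_sm).2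
  have hg' := (contDiff_infty_iff_deriv.1 gbar_sm).2
  have hbar0 : ∀ r ∈ Icc (0 : ℝ) 1, deriv hbar r ≠ 0 := fun r hr h0 => by
    have := (hstab r hr).2
    simp [h0, rinner] at this
  have hmid : Icc ε (1 - ε) ⊆ Icc 0 1 := Icc_subset_Icc hε0.le (by linarith)
  have hbasis := exists_weight_integral_eq hε0.le (by linarith : ε < 1 - ε) (by linarith)
    hh'.continuous (fun r hr => hbar0 r (hmid hr)) hnc
  obtain ⟨φ, hφ, hφ0, hφ1⟩ := hbasis 1
  obtain ⟨ψ, hψ, hψ0, hψ1⟩ := hbasis Complex.I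
  obtain ⟨K₁, hK₁0, hK₁⟩ := exists_bound_Icc hφ.continuous.continuousOn
  obtain ⟨K₂, hK₂0, hK₂⟩ := exists_bound_Icc hψ.continuous.continuousOn
  obtain ⟨N, hN0, hN⟩ := exists_bound_Icc hh'.continuous.continuousOn
  obtain ⟨G, hG0, hG⟩ := exists_bound_Icc gbar_sm.continuous.continuousOn
  obtain ⟨M, hM0, hM⟩ := exists_bound_Icc
    (f := fun r => rinner (deriv gbar r) (deriv hbar r) / ‖deriv hbar r‖ ^ 2)
    ((hg'.rinner hh').continuous.continuousOn.div (hh'.continuous.norm.pow 2).continuousOn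
      fun r hr => pow_ne_zero 2 (norm_ne_zero_iff.2 (hbar0 r hr)))
  obtain ⟨r₀, hr₀, hmin⟩ := isCompact_Icc.exists_isMinOn (nonempty_Icc.2 zero_le_one)
    (gbar_sm.rinner (contDiff_const.mul hh') :
      ContDiff ℝ ∞ fun r => rinner (gbar r) (Complex.I * deriv hbar r)).continuous.continuousOn
  set m := rinner (gbar r₀) (Complex.I * deriv hbar r₀) with hm
  have hm0 : 0 < m := (hstab r₀ hr₀).2
  set K := K₁ + K₂ with hK
  set L := 2 * M + 1 with hL
  set C := L + 4 * K * (L + 2) * (N + 1) with hC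
  set Q := G + (1 + C) * (N + 1) with hQ
  have hK0 : 0 ≤ K := by positivity
  have hL0 : 0 ≤ L := by positivity
  have hC0 : 0 ≤ C := by positivity
  have hQ0 : 0 ≤ Q := by positivity
  set R := 1 + 4 * K + (1 + 2 * C) + Q with hR
  have hR0 : 0 < R + 1 := by positivity
  obtain ⟨t, ht0, ht1, htη, htm⟩ : ∃ t : ℝ, 0 < t ∧ t ≤ 1 ∧ t ≤ η ∧ t ≤ m :=
    ⟨min 1 (min η m), by positivity, min_le_left _ _, (min_le_right _ _).trans (min_le_left _ _),
      (min_le_right _ _).trans (min_le_right _ _)⟩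
  obtain ⟨δ, hδ, hRδ⟩ : ∃ δ : ℝ, 0 < δ ∧ (R + 1) * δ = t :=
    ⟨t / (R + 1), by positivity, by field_simp⟩
  have hKδ0 : 0 ≤ K * δ := by positivity
  have hCδ0 : 0 ≤ C * δ := by positivity
  have hQδ0 : 0 ≤ Q * δ := by positivity
  have hsplit : δ + 4 * (K * δ) + (δ + 2 * (C * δ)) + Q * δ + δ = t := by
    rw [← hRδ, hR]; ring
  have hδ1 : δ ≤ 1 := by linarith
  have hKδ : K * δ ≤ 1 / 4 := by linarith
  have hηδ : δ + 2 * (C * δ) < η := by linarith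
  have hmδ : Q * δ < m := by linarith
  refine ⟨δ, hδ, ?_⟩
  intro h h_sm hclose g₀ g₀_sm g₀close g₀stab
  have hd' := (contDiff_infty_iff_deriv.1 h_sm).2
  have hhclose : ∀ r ∈ Icc (0 : ℝ) 1, ‖deriv h r - deriv hbar r‖ ≤ δ := fun r hr => by
    have := (norm_deriv_le_C1Norm (h_sm.sub hbar_sm) hr).trans hclose.le
    rwa [deriv_fun_sub (h_sm.differentiable (by simp) r) (hbar_sm.differentiable (by simp) r)]
      at this
  have hGp : ∀ r ∈ Icc (0 : ℝ) 1, m - G * δ ≤ rinner (gbar r) (Complex.I * deriv h r) := by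
    intro r hr
    have h1 : m ≤ rinner (gbar r) (Complex.I * deriv hbar r) := hmin hr
    have h2 := neg_le_of_abs_le
      (abs_rinner_le (gbar r) (Complex.I * (deriv h r - deriv hbar r)))
    rw [norm_mul, Complex.norm_I, one_mul, rinner_I_mul_sub] at h2
    have h3 := mul_le_mul (hG r hr) (hhclose r hr) (norm_nonneg _) hG0
    linarith
  have hGQ : G * δ ≤ Q * δ := mul_le_mul_of_nonneg_right
    (le_add_of_nonneg_right (by positivity)) hδ.le
  have hh0 : ∀ r ∈ Icc (0 : ℝ) 1, deriv h r ≠ 0 := fun r hr h0 => by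
    have h1 := hGp r hr
    have h2 : rinner (gbar r) (Complex.I * deriv h r) = 0 := by simp [h0, rinner]
    linarith
  have hhN : ∀ r ∈ Icc (0 : ℝ) 1, ‖deriv h r‖ ≤ N + 1 := fun r hr => by
    have := norm_add_le (deriv h r - deriv hbar r) (deriv hbar r)
    rw [sub_add_cancel] at this
    linarith [hhclose r hr, hN r hr]
  have hP1 : Icc 0 ε ∪ Icc (1 - ε) 1 ⊆ Icc (0 : ℝ) 1 :=
    union_subset (Icc_subset_Icc_right (by linarith)) (Icc_subset_Icc_left (by linarith))
  obtain ⟨l, hl, hlP, hlclose⟩ := exists_tangential_extension h_sm gbar_sm g₀_sm hh0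
    (isClosed_Icc.union isClosed_Icc) hP1 hδ
    (fun r hr => (le_add_of_nonneg_left (norm_nonneg _)).trans_lt (g₀close r hr))
    fun r hr => (g₀stab r hr).1
  have hlL : ∀ r ∈ Icc (0 : ℝ) 1, ‖l r • deriv h r - deriv gbar r‖ ≤ L * δ := fun r hr => by
    set q := rinner (deriv gbar r) (deriv hbar r) / ‖deriv hbar r‖ ^ 2
    have h1 : q • deriv hbar r = deriv gbar r := rinner_div_smul_eq (hbar0 r hr) (hstab r hr).1
    have h2 : ‖deriv gbar r - q • deriv h r‖ ≤ M * δ := by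
      rw [← h1, ← smul_sub, norm_smul, norm_sub_rev]
      exact mul_le_mul (hM r hr) (hhclose r hr) (norm_nonneg _) hM0
    refine (hlclose r hr q).trans ?_
    rw [hL]
    linarith
  have hA := norm_integral_smul_sub_le hφ.continuous hd'.continuous hh'.continuous hK₁0 hK₁ hhclose
  have hB := norm_integral_smul_sub_le hψ.continuous hd'.continuous hh'.continuous hK₂0 hK₂ hhclose
  rw [hφ1] at hA
  rw [hψ1] at hB
  have hK₁δ : K₁ * δ ≤ K * δ := mul_le_mul_of_nonneg_right (by linarith) hδ.le
  have hK₂δ : K₂ * δ ≤ K * δ := mul_le_mul_of_nonneg_right (by linarith) hδ.le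
  have hlc : Continuous fun r => l r • deriv h r := hl.continuous.smul hd'.continuous
  have hφc : Continuous fun r => φ r • deriv h r := hφ.continuous.smul hd'.continuous
  have hψc : Continuous fun r => ψ r • deriv h r := hψ.continuous.smul hd'.continuous
  set c := g₀ 1 - g₀ 0 - ∫ r in (0 : ℝ)..1, l r • deriv h r with hc
  have hg₀0 : ‖g₀ 0 - gbar 0‖ ≤ δ := (le_add_of_nonneg_right (norm_nonneg _)).trans
    (g₀close 0 (Or.inl ⟨le_rfl, hε0.le⟩)).le
  have hg₀1 : ‖g₀ 1 - gbar 1‖ ≤ δ := (le_add_of_nonneg_right (norm_nonneg _)).trans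
    (g₀close 1 (Or.inr ⟨by linarith, le_rfl⟩)).le
  have hcb : ‖c‖ ≤ (L + 2) * δ := by
    have h1 : c = (g₀ 1 - gbar 1) - (g₀ 0 - gbar 0) -
        ∫ r in (0 : ℝ)..1, (l r • deriv h r - deriv gbar r) := by
      rw [intervalIntegral.integral_sub (hlc.intervalIntegrable _ _)
        (hg'.continuous.intervalIntegrable _ _), intervalIntegral.integral_deriv_eq_sub
        (fun r _ => gbar_sm.differentiable (by simp) r) (hg'.continuous.intervalIntegrable _ _), hc]
      ring
    have h2 := norm_integral_le_of_le_Icc hlL hI1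
    rw [h1]
    refine (norm_sub_le _ _).trans ?_
    linarith [norm_sub_le (g₀ 1 - gbar 1) (g₀ 0 - gbar 0)]
  obtain ⟨a, b, hab, ha, hb⟩ := exists_linear_comb_eq (hA.trans (hK₁δ.trans hKδ))
    (hB.trans (hK₂δ.trans hKδ)) c
  let k : ℝ → ℝ := fun r => l r + (a * φ r + b * ψ r)
  have hk : ContDiff ℝ ∞ k := hl.add ((contDiff_const.mul hφ).add (contDiff_const.mul hψ))
  have hkP : ∀ r ∈ Icc 0 ε ∪ Icc (1 - ε) 1, k r • deriv h r = deriv g₀ r := fun r hr => by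
    have hr' : r ∉ Ioo ε (1 - ε) := fun h => hr.elim (fun h' => (h.1.trans_le h'.2).false)
      fun h' => (h.2.trans_le h'.1).false
    rw [← hlP r hr]
    simp [k, hφ0 r hr', hψ0 r hr']
  have hkint : ∫ r in (0 : ℝ)..1, k r • deriv h r = g₀ 1 - g₀ 0 := by
    have : ∀ r, k r • deriv h r =
        l r • deriv h r + (a • φ r • deriv h r + b • ψ r • deriv h r) := fun r => by
      simp only [k, add_smul, mul_smul]
    have hac : Continuous fun r => a • φ r • deriv h r := hφc.const_smul a
    have hbc : Continuous fun r => b • ψ r • deriv h r := hψc.const_smul b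
    have habc : Continuous fun r => a • φ r • deriv h r + b • ψ r • deriv h r := hac.add hbc
    simp only [this]
    rw [intervalIntegral.integral_add (hlc.intervalIntegrable _ _)
      (habc.intervalIntegrable _ _),
      intervalIntegral.integral_add (hac.intervalIntegrable _ _) (hbc.intervalIntegrable _ _),
      intervalIntegral.integral_smul, intervalIntegral.integral_smul, hab, hc]
    ring
  have hkclose : ∀ r ∈ Icc (0 : ℝ) 1, ‖k r • deriv h r - deriv gbar r‖ ≤ C * δ := fun r hr => by
    have h1 : k r • deriv h r - deriv gbar r =
        (l r • deriv h r - deriv gbar r) + (a * φ r + b * ψ r) • deriv h r := by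
      simp only [k, add_smul]
      ring
    have h2 : ∀ x : ℝ, ∀ y : ℝ, |x| ≤ 2 * ‖c‖ → |y| ≤ K → |x * y| ≤ 2 * ((L + 2) * δ) * K := by
      intro x y hx hy
      rw [abs_mul]
      exact mul_le_mul (hx.trans (by linarith)) hy (abs_nonneg _) (by positivity)
    have h3 : ‖(a * φ r + b * ψ r) • deriv h r‖ ≤ (4 * K * (L + 2) * δ) * (N + 1) := by
      rw [norm_smul]
      refine mul_le_mul ?_ (hhN r hr) (norm_nonneg _) (by positivity)
      have h4 := h2 a (φ r) ha ((hK₁ r hr).trans (by linarith))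
      have h5 := h2 b (ψ r) hb ((hK₂ r hr).trans (by linarith))
      exact (abs_add_le _ _).trans (by linarith)
    rw [h1]
    refine (norm_add_le _ _).trans ?_
    rw [hC]
    linarith [hlL r hr]
  have hv : ContDiff ℝ ∞ fun r => k r • deriv h r := hk.smul hd'
  obtain ⟨hg_sm, hg_deriv⟩ := contDiff_const_add_integral hv (g₀ 0)
  have hsub : ∀ r, g₀ 0 + (∫ s in (0 : ℝ)..r, k s • deriv h s) - gbar r =
      (g₀ 0 - gbar 0) + ∫ s in (0 : ℝ)..r, (k s • deriv h s - deriv gbar s) := fun r => by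
    rw [intervalIntegral.integral_sub (hv.continuous.intervalIntegrable _ _)
      (hg'.continuous.intervalIntegrable _ _), intervalIntegral.integral_deriv_eq_sub
      (fun r _ => gbar_sm.differentiable (by simp) r) (hg'.continuous.intervalIntegrable _ _)]
    ring
  have hgclose : ∀ r ∈ Icc (0 : ℝ) 1,
      ‖g₀ 0 + (∫ s in (0 : ℝ)..r, k s • deriv h s) - gbar r‖ ≤ δ + C * δ := fun r hr => by
    rw [hsub]
    exact (norm_add_le _ _).trans (add_le_add hg₀0 (norm_integral_le_of_le_Icc hkclose hr))
  have hg₀int : ∀ x y : ℝ, ∫ s in x..y, deriv g₀ s = g₀ y - g₀ x := fun x y =>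
    intervalIntegral.integral_deriv_eq_sub (fun r _ => g₀_sm.differentiable (by simp) r)
      ((contDiff_infty_iff_deriv.1 g₀_sm).2.continuous.intervalIntegrable _ _)
  refine ⟨_, hg_sm, ?_, ?_, ?_⟩
  · refine (C1Norm_le hgclose fun r hr => ?_).trans_lt
      (show δ + C * δ + C * δ < η by linarith)
    rw [deriv_fun_sub (hg_sm.differentiable (by simp) r) (gbar_sm.differentiable (by simp) r),
      hg_deriv]
    exact hkclose r hr
  · rintro r (hr | hr)
    · have : ∫ s in (0 : ℝ)..r, k s • deriv h s = ∫ s in (0 : ℝ)..r, deriv g₀ s := by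
        refine intervalIntegral.integral_congr fun s hs => ?_
        rw [uIcc_of_le hr.1] at hs
        exact hkP s (Or.inl ⟨hs.1, hs.2.trans hr.2⟩)
      simp only [this, hg₀int]
      ring
    · have : ∫ s in r..1, k s • deriv h s = ∫ s in r..1, deriv g₀ s := by
        refine intervalIntegral.integral_congr fun s hs => ?_
        rw [uIcc_of_le hr.2] at hs
        exact hkP s (Or.inr ⟨hr.1.trans hs.1, hs.2⟩)
      have hadd := intervalIntegral.integral_add_adjacent_intervals
        (hv.continuous.intervalIntegrable (μ := volume) 0 r) (hv.continuous.intervalIntegrable r 1)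
      rw [hkint, this, hg₀int] at hadd
      linear_combination hadd
  · intro r hr
    rw [hg_deriv]
    refine ⟨by simp [rinner_eq]; ring, ?_⟩
    have h1 := neg_le_of_abs_le (abs_rinner_le
      (g₀ 0 + (∫ s in (0 : ℝ)..r, k s • deriv h s) - gbar r) (Complex.I * deriv h r))
    rw [rinner_sub_left, norm_mul, Complex.norm_I, one_mul] at h1
    have h2 := mul_le_mul (hgclose r hr) (hhN r hr) (norm_nonneg _) (by positivity)
    have h3 : Q * δ = G * δ + (δ + C * δ) * (N + 1) := by rw [hQ]; ring
    linarith [hGp r hr]
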